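/- arXiv:2302.05909 — 4 statements merged into one kernel-verified Lean document; each statement's English description precedes it below -/
import Mathlib

section
/- Any finitely generated involutive commutative two-valued group X can be decomposed into a direct product of a finitely generated involutive commutative two-valued group without single-valued direct factors and a finite Boolean group. Moreover, if X ≅ X₁ × W₁ and X ≅ X₂ × W₂ are two such decompositions, then X₁ ≅ X₂ and W₁ ≅ W₂. -/
/-!
Two-valued groups after V.M. Buchstaber, A.P. Veselov and A.A. Gaifullin.

`X.mul x y` is the two-element multiset `x * y`.
-/

universe u v w u' v' w'

/-- A two-valued group: a set with a multiplication valued in two-element multisets,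
a strong identity `e`, and a (unique) inverse. -/
structure TwoValuedGroup (T : Type u) where
  mul : T → T → Multiset T
  e : T
  inv : T → T
  card_mul : ∀ x y, Multiset.card (mul x y) = 2
  assoc : ∀ x y z, (mul x y).bind (fun t => mul t z) = (mul y z).bind (fun t => mul x t)
  e_mul : ∀ x, mul e x = {x, x}
  mul_e : ∀ x, mul x e = {x, x}
  e_mem_mul_inv : ∀ x, e ∈ mul x (inv x)
  e_mem_inv_mul : ∀ x, e ∈ mul (inv x) x
  inv_unique : ∀ x y, (e ∈ mul x y ∨ e ∈ mul y x) → y = inv x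

namespace TwoValuedGroup

/-- Commutativity of a two-valued group. -/
def Commutative {T : Type u} (X : TwoValuedGroup T) : Prop := ∀ x y, X.mul x y = X.mul y x

/-- Involutivity: every element is its own inverse. -/
def Involutive {T : Type u} (X : TwoValuedGroup T) : Prop := ∀ x, X.inv x = x

/-- A homomorphism of two-valued groups. -/
def IsHom {T : Type u} {S : Type v} (X : TwoValuedGroup T) (Z : TwoValuedGroup S)
    (f : T → S) : Prop :=
  f X.e = Z.e ∧ ∀ x y, (X.mul x y).map f = Z.mul (f x) (f y)

/-- Two two-valued groups are isomorphic if there is a bijective homomorphism. -/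
def Isomorphic {T : Type u} {S : Type v} (X : TwoValuedGroup T) (Z : TwoValuedGroup S) : Prop :=
  ∃ f : T → S, Function.Bijective f ∧ IsHom X Z f

/-- A subgroup of a two-valued group: a subset closed under multiplication. -/
def IsSubgroup {T : Type u} (X : TwoValuedGroup T) (Y : Set T) : Prop :=
  ∀ y₁ ∈ Y, ∀ y₂ ∈ Y, ∀ z ∈ X.mul y₁ y₂, z ∈ Y

/-- `S` generates `X` if the only subgroup of `X` containing `S` is all of `X`. -/
def Generates {T : Type u} (X : TwoValuedGroup T) (S : Set T) : Prop :=
  ∀ Y : Set T, X.IsSubgroup Y → S ⊆ Y → Y = Set.univ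

/-- Finitely generated two-valued group. -/
def FinitelyGenerated {T : Type u} (X : TwoValuedGroup T) : Prop :=
  ∃ S : Set T, S.Finite ∧ X.Generates S

/-- A family of integer power sequences: `P x k` is the `k`-th power `x^k` of `x`;
these are uniquely determined in an involutive two-valued group. -/
def IsPowFamily {T : Type u} (X : TwoValuedGroup T) (P : T → ℤ → T) : Prop :=
  ∀ x : T, P x 0 = X.e ∧ P x 1 = x ∧ (∀ k : ℤ, P x (-k) = P x k) ∧
    ∀ k : ℤ, 1 ≤ k → X.mul x (P x k) = {P x (k - 1), P x (k + 1)}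

/-- The order of an element: the least positive `k` with `x^k = e`;
the value `0` encodes infinite order. -/
noncomputable def ordOf {T : Type u} (X : TwoValuedGroup T) (P : T → ℤ → T) (x : T) : ℕ :=
  sInf {n : ℕ | 0 < n ∧ P x (n : ℤ) = X.e}

/-- `ord x > 2` (where infinite order counts as `> 2`). -/
def OrdGT2 {T : Type u} (X : TwoValuedGroup T) (P : T → ℤ → T) (x : T) : Prop :=
  X.ordOf P x = 0 ∨ 2 < X.ordOf P x

/-- A two-valued group is special if it contains a special pair: `ord x > 2`, `ord y > 2`,
and `x * y` consists of two equal elements. -/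
def IsSpecial {T : Type u} (X : TwoValuedGroup T) (P : T → ℤ → T) : Prop :=
  ∃ x y z : T, X.OrdGT2 P x ∧ X.OrdGT2 P y ∧ X.mul x y = {z, z}

/-- `ι` is an involutive automorphism of the group `G`. -/
def IsInvolutiveAut (G : Type v) [Group G] (ι : G → G) : Prop :=
  Function.Bijective ι ∧ (∀ g h : G, ι (g * h) = ι g * ι h) ∧ (∀ g : G, ι (ι g) = g)

/-- `X` is isomorphic to the coset two-valued group `G/ι`: there is a quotient map
`π : G → X` whose fibres are exactly the `ι`-orbits and which carries the coset
two-valued multiplication `π g * π h = [π (g h), π (g ι(h))]`. -/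
def IsCosetOf {T : Type u} {G : Type v} [Group G] (X : TwoValuedGroup T) (ι : G → G) : Prop :=
  ∃ π : G → T, Function.Surjective π ∧ π 1 = X.e ∧
    (∀ g, π (ι g) = π g) ∧
    (∀ g h, π g = π h → h = g ∨ h = ι g) ∧
    (∀ g h, X.mul (π g) (π h) = {π (g * h), π (g * ι h)}) ∧
    (∀ g, X.inv (π g) = π g⁻¹)

/-- `X` is isomorphic to the coset two-valued group `X^a_A = A/ι_a`
for the antipodal involution `ι_a (a) = a⁻¹` of the abelian group `A`. -/
def IsAntipodalCosetOf {T : Type u} (X : TwoValuedGroup T) (A : Type v) [CommGroup A] : Prop :=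
  ∃ π : A → T, Function.Surjective π ∧ π 1 = X.e ∧
    (∀ a, π a⁻¹ = π a) ∧
    (∀ a b, π a = π b → b = a ∨ b = a⁻¹) ∧
    (∀ a b, X.mul (π a) (π b) = {π (a * b), π (a * b⁻¹)}) ∧
    (∀ a, X.inv (π a) = π a⁻¹)

/-- A Boolean group: every element squares to the identity. -/
def IsBooleanGroup (V : Type v) [CommGroup V] : Prop := ∀ x : V, x * x = 1

/-- For a Boolean group, `dim V ≥ 2` (as an `𝔽₂`-vector space) is equivalent to the
existence of two distinct nontrivial elements. -/
def BoolDimGE2 (V : Type v) [CommGroup V] : Prop := ∃ a b : V, a ≠ 1 ∧ b ≠ 1 ∧ a ≠ b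

/-- For a Boolean group, `dim V ≥ 3` is equivalent to the existence of three
linearly independent elements. -/
def BoolDimGE3 (V : Type v) [CommGroup V] : Prop :=
  ∃ a b c : V, a ≠ 1 ∧ b ≠ 1 ∧ a ≠ b ∧ c ≠ 1 ∧ c ≠ a ∧ c ≠ b ∧ c ≠ a * b

/-- Isomorphism of (single-valued) groups. -/
def GroupIsomorphic (A : Type v) (B : Type w) [CommGroup A] [CommGroup B] : Prop :=
  Nonempty (A ≃* B)

/-- `X` is isomorphic to the coset two-valued group `X^u_V = (V × V)/ι_u`,
where `ι_u (a, b) = (a, a b)` is the unipotent involution of the Boolean group `V × V`. -/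
def IsUnipotentCosetOf {T : Type u} (X : TwoValuedGroup T) (V : Type v) [CommGroup V] : Prop :=
  ∃ π : V × V → T, Function.Surjective π ∧ π (1, 1) = X.e ∧
    (∀ a b : V, π (a, a * b) = π (a, b)) ∧
    (∀ p q : V × V, π p = π q → q = p ∨ q = (p.1, p.1 * p.2)) ∧
    (∀ a₁ b₁ a₂ b₂ : V,
      X.mul (π (a₁, b₁)) (π (a₂, b₂)) = {π (a₁ * a₂, b₁ * b₂), π (a₁ * a₂, a₂ * b₁ * b₂)}) ∧
    (∀ p : V × V, X.inv (π p) = π p)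

/-- `X` is isomorphic to the direct product `X^u_V × W` of the unipotent coset
two-valued group `X^u_V = (V × V)/ι_u` and the Boolean group `W`. -/
def IsUnipotentCosetProdOf {T : Type u} (X : TwoValuedGroup T) (V : Type v) (W : Type w)
    [CommGroup V] [CommGroup W] : Prop :=
  ∃ f : (V × V) × W → T, Function.Surjective f ∧ f ((1, 1), 1) = X.e ∧
    (∀ (a b : V) (w : W), f ((a, a * b), w) = f ((a, b), w)) ∧
    (∀ p q : (V × V) × W, f p = f q → q.2 = p.2 ∧ (q.1 = p.1 ∨ q.1 = (p.1.1, p.1.1 * p.1.2))) ∧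
    (∀ (a₁ b₁ a₂ b₂ : V) (w₁ w₂ : W),
      X.mul (f ((a₁, b₁), w₁)) (f ((a₂, b₂), w₂)) =
        {f ((a₁ * a₂, b₁ * b₂), w₁ * w₂), f ((a₁ * a₂, a₂ * b₁ * b₂), w₁ * w₂)}) ∧
    (∀ p, X.inv (f p) = f p)

open Classical in
/-- The multiplication table of the special two-valued group `Y_V` on `Option V`:
`none` is the extra element `s`, `some v` are the elements of the Boolean group `V`. -/
noncomputable def mulY {V : Type v} [CommGroup V] : Option V → Option V → Multiset (Option V)
  | some x, some y =>
      if x = y then (if x = 1 then {some 1, some 1} else {some 1, none})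
      else {some (x * y), some (x * y)}
  | some x, none => if x = 1 then {none, none} else {some x, some x}
  | none, some y => if y = 1 then {none, none} else {some y, some y}
  | none, none => {some 1, some 1}

/-- `X` is isomorphic to the special two-valued group `Y_V`. -/
def IsYOf {T : Type u} (X : TwoValuedGroup T) (V : Type v) [CommGroup V] : Prop :=
  ∃ f : Option V → T, Function.Bijective f ∧ f (some 1) = X.e ∧
    (∀ uu vv : Option V, X.mul (f uu) (f vv) = (mulY uu vv).map f) ∧
    (∀ uu : Option V, X.inv (f uu) = f uu)

/-- `X` is isomorphic to the direct product `Y_V × W`. -/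
def IsYProdOf {T : Type u} (X : TwoValuedGroup T) (V : Type v) (W : Type w)
    [CommGroup V] [CommGroup W] : Prop :=
  ∃ f : Option V × W → T, Function.Bijective f ∧ f (some 1, 1) = X.e ∧
    (∀ (uu vv : Option V) (w₁ w₂ : W),
      X.mul (f (uu, w₁)) (f (vv, w₂)) = (mulY uu vv).map (fun z => f (z, w₁ * w₂))) ∧
    (∀ p : Option V × W, X.inv (f p) = f p)

/-- `X` is isomorphic to the direct product `X' × W` of the two-valued group `X'`
and the (single-valued) Boolean group `W`. -/
def IsDirectProdOf {T : Type u} {T' : Type v} (W : Type w) [CommGroup W]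
    (X : TwoValuedGroup T) (X' : TwoValuedGroup T') : Prop :=
  ∃ f : T' × W → T, Function.Bijective f ∧ f (X'.e, 1) = X.e ∧
    (∀ (x₁ x₂ : T') (w₁ w₂ : W),
      X.mul (f (x₁, w₁)) (f (x₂, w₂)) = (X'.mul x₁ x₂).map (fun z => f (z, w₁ * w₂))) ∧
    (∀ (x : T') (w : W), X.inv (f (x, w)) = f (X'.inv x, w))

/-- `X` contains a single-valued direct factor: `X ≅ X' × W` with `W` a nontrivial
Boolean group. -/
def HasSingleValuedDirectFactor {T : Type u} (X : TwoValuedGroup T) : Prop :=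
  ∃ (T' : Type u) (X' : TwoValuedGroup T') (W : Type u) (iW : CommGroup W),
    X'.Commutative ∧ X'.Involutive ∧ @IsBooleanGroup W iW ∧ Nontrivial W ∧
    @IsDirectProdOf T T' W iW X X'

/-- The Boolean group `C₂ⁿ`. -/
abbrev C2vec (n : ℕ) : Type := Fin n → Multiplicative (ZMod 2)

/-- The group `C₄ⁿ`. -/
abbrev C4vec (n : ℕ) : Type := Fin n → Multiplicative (ZMod 4)

end TwoValuedGroup

namespace TwoValuedGroup

/-- An element `z` is central if multiplication by `z` is single-valued. -/
def IsCentral {T : Type u} (X : TwoValuedGroup T) (z : T) : Prop :=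
  ∀ x, ∃ y, X.mul z x = {y, y}

/-- A map to a group which is multiplicative on every value of the two-valued product. -/
def IsMultiplicative {T : Type u} {G : Type v} [Group G] (X : TwoValuedGroup T) (p : T → G) :
    Prop :=
  ∀ x y, ∀ t ∈ X.mul x y, p t = p x * p y

/-- The two-valued group structure on a subgroup that contains `e` and is closed under inverses. -/
def restrict {T : Type u} (X : TwoValuedGroup T) (Y : Set T) (hY : X.IsSubgroup Y)
    (he : X.e ∈ Y) (hi : ∀ y ∈ Y, X.inv y ∈ Y) : TwoValuedGroup Y where
  mul x y := (X.mul x y).pmap Subtype.mk (hY x x.2 y y.2)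
  e := ⟨X.e, he⟩
  inv x := ⟨X.inv x, hi x x.2⟩
  card_mul x y := by simp [X.card_mul]
  assoc x y z := by
    have hm : ∀ x y : Y,
        ((X.mul x y).pmap Subtype.mk (hY x x.2 y y.2)).map Subtype.val = X.mul x y := by
      intro x y
      simp [Multiset.map_pmap, Multiset.pmap_eq_map]
    apply Multiset.map_injective Subtype.val_injective
    simp only [Multiset.map_bind, hm]
    have h := X.assoc x y z
    rw [← hm x y, ← hm y z, Multiset.bind_map, Multiset.bind_map] at h
    exact h
  e_mul x := by
    apply Multiset.map_injective Subtype.val_injective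
    simp [Multiset.map_pmap, Multiset.pmap_eq_map, X.e_mul]
  mul_e x := by
    apply Multiset.map_injective Subtype.val_injective
    simp [Multiset.map_pmap, Multiset.pmap_eq_map, X.mul_e]
  e_mem_mul_inv x := by
    simpa [Multiset.mem_pmap] using X.e_mem_mul_inv x
  e_mem_inv_mul x := by
    simpa [Multiset.mem_pmap] using X.e_mem_inv_mul x
  inv_unique x y h := by
    apply Subtype.ext
    apply X.inv_unique
    simp only [Multiset.mem_pmap, Subtype.mk.injEq] at h
    rcases h with ⟨a, ha, rfl⟩ | ⟨a, ha, rfl⟩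
    · exact Or.inl ha
    · exact Or.inr ha

theorem map_val_restrict_mul {T : Type u} (X : TwoValuedGroup T) (Y : Set T)
    (hY : X.IsSubgroup Y) (he : X.e ∈ Y) (hi : ∀ y ∈ Y, X.inv y ∈ Y) (x y : Y) :
    ((X.restrict Y hY he hi).mul x y).map Subtype.val = X.mul x y := by
  simp [restrict, Multiset.map_pmap, Multiset.pmap_eq_map]

/-- Translation by a central element is an involution that commutes with multiplication. -/
theorem exists_translation {T : Type u} {X : TwoValuedGroup T} (hinv : X.Involutive) {z : T}
    (hz : X.IsCentral z) :
    ∃ σ : T → T, (∀ x, X.mul z x = {σ x, σ x}) ∧ (∀ x, σ (σ x) = x) ∧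
      ∀ x y, X.mul (σ x) y = (X.mul x y).map σ := by
  choose σ hσ using hz
  have hbind : ∀ s : Multiset T, s.bind (fun t => X.mul z t) = s.map σ + s.map σ := by
    intro s
    induction s using Multiset.induction_on with
    | empty => simp
    | cons a s ih =>
      rw [Multiset.cons_bind, ih, hσ]
      simp only [Multiset.insert_eq_cons, Multiset.map_cons, Multiset.cons_add,
        Multiset.singleton_add, Multiset.add_cons]
  refine ⟨σ, hσ, fun x => ?_, fun x y => ?_⟩
  · have hzz : X.mul z z = {X.e, X.e} := by
      have h := X.e_mem_mul_inv z
      rw [hinv, hσ] at h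
      have : X.e = σ z := by simpa using h
      rw [hσ, this]
    have h := X.assoc z z x
    rw [hzz, hbind, hσ] at h
    have hx : σ (σ x) ∈ (({X.e, X.e} : Multiset T).bind fun t => X.mul t x) := by
      rw [h]; simp
    simpa [X.e_mul] using hx
  · have h := X.assoc z x y
    rw [hbind, hσ] at h
    have h2 : 2 • X.mul (σ x) y = 2 • (X.mul x y).map σ := by
      simpa [two_nsmul, Multiset.insert_eq_cons] using h
    exact nsmul_right_injective two_ne_zero h2

/-- A central element on which a character to `C₂` is nontrivial spans a direct factor. -/
theorem hasSingleValuedDirectFactor_of_character {T : Type u} {X : TwoValuedGroup T}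
    (hc : X.Commutative) (hinv : X.Involutive) {z : T} (hz : X.IsCentral z)
    {χ : T → Multiplicative (ZMod 2)} (hχ : X.IsMultiplicative χ) (hχz : χ z ≠ 1) :
    X.HasSingleValuedDirectFactor := by
  obtain ⟨σ, hσ, hσσ, hσm⟩ := exists_translation hinv hz
  have hcases : ∀ w : Multiplicative (ZMod 2), w = 1 ∨ w = χ z := by
    generalize χ z = c at hχz
    revert c
    decide
  have hsq : ∀ w : Multiplicative (ZMod 2), w * w = 1 := by decide
  have hχσ : ∀ x, χ (σ x) = χ z * χ x := fun x => hχ z x _ (by simp [hσ])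
  have hχe : χ X.e = 1 := by
    have h := hχ X.e X.e X.e (by simp [X.e_mul])
    simpa using h
  have hσσm : ∀ x y, X.mul (σ x) (σ y) = X.mul x y := by
    intro x y
    rw [hσm, hc x, hσm, hc y, Multiset.map_map]
    simp [hσσ]
  have hσm' : ∀ x y, X.mul x (σ y) = (X.mul x y).map σ := by
    intro x y
    rw [hc, hσm, hc y]
  let Y : Set T := {x | χ x = 1}
  have hY : X.IsSubgroup Y := by
    intro x hx y hy t ht
    change χ t = 1
    rw [hχ x y t ht, show χ x = 1 from hx, show χ y = 1 from hy, mul_one]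
  have hi : ∀ y ∈ Y, X.inv y ∈ Y := fun y hy => by rw [hinv]; exact hy
  let X' := X.restrict Y hY hχe hi
  have hval : ∀ x y : Y, (X'.mul x y).map Subtype.val = X.mul x y :=
    X.map_val_restrict_mul Y hY hχe hi
  have hval' : ∀ (x y : Y) (g : T → T), (X'.mul x y).map (fun t : Y => g t.1) = (X.mul x y).map g := by
    intro x y g
    rw [← hval, Multiset.map_map]
    rfl
  have hcY : X'.Commutative := by
    intro x y
    apply Multiset.map_injective Subtype.val_injective
    rw [hval, hval, hc]
  have hinvY : X'.Involutive := fun x => Subtype.ext (hinv x)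
  refine ⟨Y, X', ULift (Multiplicative (ZMod 2)), inferInstance, hcY, hinvY,
    fun w => ULift.ext _ _ (hsq w.down), inferInstance,
    fun p => if p.2.down = 1 then p.1 else σ p.1, ⟨?_, ?_⟩, ?_, ?_, ?_⟩
  · rintro ⟨⟨x, hx : χ x = 1⟩, ⟨a⟩⟩ ⟨⟨y, hy : χ y = 1⟩, ⟨b⟩⟩ h
    have hne : ∀ s t, χ s = 1 → χ t = 1 → s ≠ σ t := by
      rintro s t hs ht rfl
      exact hχz (by rw [← hs, hχσ, ht, mul_one])
    rcases hcases a with rfl | rfl <;> rcases hcases b with rfl | rfl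
    · simpa using h
    · exact absurd (by simpa [hχz] using h) (hne x y hx hy)
    · exact absurd (by simpa [hχz] using h.symm) (hne y x hy hx)
    · simpa using (Function.LeftInverse.injective hσσ) (by simpa [hχz] using h)
  · intro t
    rcases hcases (χ t) with h | h
    · exact ⟨(⟨t, h⟩, ⟨1⟩), by simp⟩
    · refine ⟨(⟨σ t, ?_⟩, ⟨χ z⟩), by simp [hχz, hσσ]⟩
      change χ (σ t) = 1
      rw [hχσ, h, hsq]
  · simp [X', restrict]
  · rintro x y ⟨a⟩ ⟨b⟩
    rcases hcases a with rfl | rfl <;> rcases hcases b with rfl | rfl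
    · simpa using (hval x y).symm
    · simpa [hχz, hσm'] using (hval' x y σ).symm
    · simpa [hχz, hσm] using (hval' x y σ).symm
    · simpa [hsq, hχz, hσσm] using (hval x y).symm
  · intro x w
    rw [hinv, hinvY]

/-- The characters to `C₂` separate the points of a Boolean group. -/
theorem IsBooleanGroup.exists_character_ne_one {W : Type v} [CommGroup W] (hW : IsBooleanGroup W)
    {a : W} (ha : a ≠ 1) : ∃ ψ : W →* Multiplicative (ZMod 2), ψ a ≠ 1 := by
  let _ : Module (ZMod 2) (Additive W) := AddCommGroup.zmodModule (n := 2) (by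
    intro x
    rw [two_nsmul]
    exact hW x.toMul)
  obtain ⟨l, hl⟩ := Module.Projective.exists_dual_ne_zero (ZMod 2) (x := Additive.ofMul a) ha
  exact ⟨AddMonoidHom.toMultiplicativeRight l.toAddMonoidHom, hl⟩

/-- Without single-valued direct factors, every multiplicative map to a Boolean group is trivial
on central elements. -/
theorem IsCentral.map_eq_one {T : Type u} {X : TwoValuedGroup T} (hc : X.Commutative)
    (hinv : X.Involutive) (hX : ¬ X.HasSingleValuedDirectFactor) {z : T} (hz : X.IsCentral z)
    {W : Type v} [CommGroup W] (hW : IsBooleanGroup W) {p : T → W} (hp : X.IsMultiplicative p) :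
    p z = 1 := by
  by_contra h
  obtain ⟨ψ, hψ⟩ := hW.exists_character_ne_one h
  refine hX (hasSingleValuedDirectFactor_of_character hc hinv hz (χ := fun t => ψ (p t)) ?_ hψ)
  intro x y t ht
  simp only [hp x y t ht, map_mul]

/-- Multiplication in the direct product of a two-valued group and a group. -/
def prodMul {T : Type u} {W : Type v} [CommGroup W] (X : TwoValuedGroup T) (a b : T × W) :
    Multiset (T × W) :=
  (X.mul a.1 b.1).map (fun z => (z, a.2 * b.2))

/-- An isomorphism between products of two-valued groups with groups. -/
def IsProdIso {T₁ : Type u} {T₂ : Type v} {W₁ : Type w} {W₂ : Type u'} [CommGroup W₁]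
    [CommGroup W₂] (X₁ : TwoValuedGroup T₁) (X₂ : TwoValuedGroup T₂)
    (φ : T₁ × W₁ ≃ T₂ × W₂) : Prop :=
  φ (X₁.e, 1) = (X₂.e, 1) ∧ ∀ a b, (X₁.prodMul a b).map φ = X₂.prodMul (φ a) (φ b)

namespace IsProdIso

variable {T₁ : Type u} {T₂ : Type v} {W₁ : Type w} {W₂ : Type u'} [CommGroup W₁]
  [CommGroup W₂] {X₁ : TwoValuedGroup T₁} {X₂ : TwoValuedGroup T₂} {φ : T₁ × W₁ ≃ T₂ × W₂}

theorem symm (h : IsProdIso X₁ X₂ φ) : IsProdIso X₂ X₁ φ.symm := by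
  refine ⟨by rw [← h.1, φ.symm_apply_apply], fun a b => ?_⟩
  apply Multiset.map_injective φ.injective
  rw [h.2, Multiset.map_map]
  simp

theorem snd_mul (h : IsProdIso X₁ X₂ φ) {a b t : T₁ × W₁} (ht : t ∈ X₁.prodMul a b) :
    (φ t).2 = (φ a).2 * (φ b).2 := by
  have h' : φ t ∈ X₂.prodMul (φ a) (φ b) := h.2 a b ▸ Multiset.mem_map_of_mem φ ht
  obtain ⟨c, -, hc⟩ := Multiset.mem_map.1 h'
  rw [← hc]

theorem snd_apply (h : IsProdIso X₁ X₂ φ) (x : T₁) (w : W₁) :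
    (φ (x, w)).2 = (φ (x, 1)).2 * (φ (X₁.e, w)).2 :=
  h.snd_mul (by simp [prodMul, X₁.mul_e])

theorem isMultiplicative_snd (h : IsProdIso X₁ X₂ φ) :
    X₁.IsMultiplicative (fun x => (φ (x, 1)).2) := fun x y t ht =>
  h.snd_mul (by simpa [prodMul] using ht)

theorem isCentral_fst (h : IsProdIso X₁ X₂ φ) (w : W₁) : X₂.IsCentral (φ (X₁.e, w)).1 := by
  intro y
  have hm := congrArg (Multiset.map Prod.fst) (h.2 (X₁.e, w) (φ.symm (y, 1)))
  simp only [prodMul, X₁.e_mul, φ.apply_symm_apply, Multiset.map_map, Function.comp_def,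
    Multiset.map_id'] at hm
  exact ⟨_, by rw [← hm]; rfl⟩

theorem snd_symm_snd (h : IsProdIso X₁ X₂ φ) (hc : X₂.Commutative) (hinv : X₂.Involutive)
    (hX : ¬ X₂.HasSingleValuedDirectFactor) (hW : IsBooleanGroup W₁) (w : W₁) :
    (φ.symm (X₂.e, (φ (X₁.e, w)).2)).2 = w := by
  have h1 := h.symm.snd_apply (φ (X₁.e, w)).1 (φ (X₁.e, w)).2
  rw [Prod.mk.eta, φ.symm_apply_apply,
    (h.isCentral_fst w).map_eq_one hc hinv hX hW h.symm.isMultiplicative_snd, one_mul] at h1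
  exact h1.symm

theorem isomorphic_and_groupIsomorphic (h : IsProdIso X₁ X₂ φ)
    (hc₁ : X₁.Commutative) (hinv₁ : X₁.Involutive) (hX₁ : ¬ X₁.HasSingleValuedDirectFactor)
    (hc₂ : X₂.Commutative) (hinv₂ : X₂.Involutive) (hX₂ : ¬ X₂.HasSingleValuedDirectFactor)
    (hW₁ : IsBooleanGroup W₁) (hW₂ : IsBooleanGroup W₂) :
    Isomorphic X₁ X₂ ∧ GroupIsomorphic W₁ W₂ := by
  have hl := h.snd_symm_snd hc₂ hinv₂ hX₂ hW₁
  have hr := h.symm.snd_symm_snd hc₁ hinv₁ hX₁ hW₂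
  rw [φ.symm_symm] at hr
  have hs := h.symm.snd_apply
  refine ⟨⟨fun x => (φ (x, 1)).1, ⟨fun x x' hx => ?_, fun y => ?_⟩, ?_, fun x y => ?_⟩,
    ⟨⟨⟨fun w => (φ (X₁.e, w)).2, fun w => (φ.symm (X₂.e, w)).2, hl, hr⟩, fun a b => ?_⟩⟩⟩
  · have h1 := hs (φ (x, 1)).1 (φ (x, 1)).2
    have h2 := hs (φ (x', 1)).1 (φ (x', 1)).2
    rw [Prod.mk.eta, φ.symm_apply_apply] at h1 h2
    rw [← show (φ (x, 1)).1 = (φ (x', 1)).1 from hx, h1] at h2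
    have h3 := hr (φ (x, 1)).2
    rw [mul_left_cancel h2, hr] at h3
    have h4 : φ (x, 1) = φ (x', 1) := Prod.ext hx h3.symm
    exact congrArg Prod.fst (φ.injective h4)
  · have h1 := hs y (φ (X₁.e, ((φ.symm (y, 1)).2)⁻¹)).2
    rw [hl, mul_inv_cancel] at h1
    refine ⟨(φ.symm (y, (φ (X₁.e, ((φ.symm (y, 1)).2)⁻¹)).2)).1, ?_⟩
    have h2 : ((φ.symm (y, (φ (X₁.e, ((φ.symm (y, 1)).2)⁻¹)).2)).1, (1 : W₁)) =
        φ.symm (y, (φ (X₁.e, ((φ.symm (y, 1)).2)⁻¹)).2) := Prod.ext rfl h1.symm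
    change (φ (_, 1)).1 = y
    rw [h2, φ.apply_symm_apply]
  · change (φ (X₁.e, 1)).1 = X₂.e
    rw [h.1]
  · have hm := congrArg (Multiset.map Prod.fst) (h.2 (x, 1) (y, 1))
    simpa [prodMul, Multiset.map_map, Function.comp_def] using hm
  · exact h.snd_mul (by simp [prodMul, X₁.e_mul])

end IsProdIso

namespace IsDirectProdOf

theorem exists_isProdIso {T : Type u} {T₁ : Type v} {T₂ : Type w} {W₁ : Type v'} {W₂ : Type w'}
    [CommGroup W₁] [CommGroup W₂] {X : TwoValuedGroup T} {X₁ : TwoValuedGroup T₁}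
    {X₂ : TwoValuedGroup T₂} (h₁ : IsDirectProdOf W₁ X X₁) (h₂ : IsDirectProdOf W₂ X X₂) :
    ∃ φ : T₁ × W₁ ≃ T₂ × W₂, IsProdIso X₁ X₂ φ := by
  obtain ⟨f, hf, hfe, hfm, -⟩ := h₁
  obtain ⟨g, hg, hge, hgm, -⟩ := h₂
  have key : ∀ a, g ((Equiv.ofBijective g hg).symm (f a)) = f a :=
    fun a => (Equiv.ofBijective g hg).apply_symm_apply (f a)
  refine ⟨(Equiv.ofBijective f hf).trans (Equiv.ofBijective g hg).symm, ?_, fun a b => ?_⟩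
  · apply hg.1
    exact (key _).trans (hfe.trans hge.symm)
  · apply Multiset.map_injective hg.1
    have h1 := hfm a.1 b.1 a.2 b.2
    have h2 := hgm ((Equiv.ofBijective g hg).symm (f a)).1 ((Equiv.ofBijective g hg).symm (f b)).1
      ((Equiv.ofBijective g hg).symm (f a)).2 ((Equiv.ofBijective g hg).symm (f b)).2
    simp only [Prod.mk.eta, key] at h1 h2
    rw [h1] at h2
    simpa [prodMul, Multiset.map_map, Function.comp_def, key] using h2

/-- A product decomposition with trivial Boolean factor. -/
theorem punit {T : Type u} (X : TwoValuedGroup T) : IsDirectProdOf PUnit.{v + 1} X X :=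
  ⟨Prod.fst, ⟨fun _ _ h => Prod.ext h rfl, fun x => ⟨(x, PUnit.unit), rfl⟩⟩, rfl,
    fun x y _ _ => by simp, fun _ _ => rfl⟩

theorem trans {T : Type u} {T' : Type v} {T'' : Type w} {W : Type v'} {W' : Type w'}
    [CommGroup W] [CommGroup W'] {X : TwoValuedGroup T} {X' : TwoValuedGroup T'}
    {X'' : TwoValuedGroup T''} (h : IsDirectProdOf W X X') (h' : IsDirectProdOf W' X' X'') :
    IsDirectProdOf (W' × W) X X'' := by
  obtain ⟨f, hf, hfe, hfm, hfi⟩ := h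
  obtain ⟨g, hg, hge, hgm, hgi⟩ := h'
  refine ⟨fun p => f (g (p.1, p.2.1), p.2.2), ⟨?_, fun t => ?_⟩, ?_, ?_, ?_⟩
  · rintro ⟨x, a, b⟩ ⟨y, c, d⟩ hxy
    have h1 := hf.1 hxy
    simp only [Prod.mk.injEq] at h1
    have h2 := hg.1 h1.1
    simp only [Prod.mk.injEq] at h2
    simp [h1, h2]
  · obtain ⟨⟨y, b⟩, rfl⟩ := hf.2 t
    obtain ⟨⟨x, a⟩, rfl⟩ := hg.2 y
    exact ⟨(x, a, b), rfl⟩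
  · simp [hge, hfe]
  · intro x y a b
    simp [hfm, hgm, Multiset.map_map]
  · intro x a
    simp [hfi, hgi]

theorem finitelyGenerated {T : Type u} {T' : Type v} {W : Type w} [CommGroup W]
    {X : TwoValuedGroup T} {X' : TwoValuedGroup T'} (h : IsDirectProdOf W X X')
    (hfg : X.FinitelyGenerated) : X'.FinitelyGenerated := by
  obtain ⟨f, hf, -, hfm, -⟩ := h
  obtain ⟨S, hS, hgen⟩ := hfg
  have key : ∀ a, (Equiv.ofBijective f hf).symm (f a) = a :=
    fun a => (Equiv.ofBijective f hf).symm_apply_apply a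
  refine ⟨(fun t => ((Equiv.ofBijective f hf).symm t).1) '' S, hS.image _, fun Y hY hSY => ?_⟩
  have hpre := hgen ((fun t => ((Equiv.ofBijective f hf).symm t).1) ⁻¹' Y) ?_
    (Set.image_subset_iff.1 hSY)
  · refine Set.eq_univ_of_forall fun x => ?_
    have hx : f (x, 1) ∈ (fun t => ((Equiv.ofBijective f hf).symm t).1) ⁻¹' Y :=
      hpre ▸ Set.mem_univ _
    simpa [key] using hx
  · intro s hs t ht r hr
    obtain ⟨⟨x, a⟩, rfl⟩ := hf.2 s
    obtain ⟨⟨y, b⟩, rfl⟩ := hf.2 t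
    rw [hfm] at hr
    obtain ⟨z, hz, rfl⟩ := Multiset.mem_map.1 hr
    simp only [Set.mem_preimage, key] at hs ht ⊢
    exact hY x hs y ht z hz

/-- A Boolean direct factor has at most `2 ^ n` elements if `X` is generated by `n` elements. -/
theorem finite_and_card_le {T : Type u} {T' : Type v} {W : Type w} [CommGroup W]
    {X : TwoValuedGroup T} {X' : TwoValuedGroup T'} (h : IsDirectProdOf W X X')
    (hW : IsBooleanGroup W) {S : Set T} (hS : S.Finite) (hgen : X.Generates S) :
    Finite W ∧ Nat.card W ≤ 2 ^ S.ncard := by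
  classical
  obtain ⟨f, hf, -, hfm, -⟩ := h
  have key : ∀ a, (Equiv.ofBijective f hf).symm (f a) = a :=
    fun a => (Equiv.ofBijective f hf).symm_apply_apply a
  let p : T → W := fun t => ((Equiv.ofBijective f hf).symm t).2
  have hp : ∀ x w, p (f (x, w)) = w := fun x w => by simp [p, key]
  let A : Finset W := hS.toFinset.image p
  have hA : Subgroup.closure (A : Set W) = ⊤ := by
    have hpre := hgen (p ⁻¹' (Subgroup.closure (A : Set W))) ?_ ?_
    · refine (Subgroup.eq_top_iff' _).2 fun w => ?_
      have hw : f (X'.e, w) ∈ p ⁻¹' (Subgroup.closure (A : Set W)) := hpre ▸ Set.mem_univ _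
      simpa [hp] using hw
    · intro s hs t ht r hr
      obtain ⟨⟨x, a⟩, rfl⟩ := hf.2 s
      obtain ⟨⟨y, b⟩, rfl⟩ := hf.2 t
      rw [hfm] at hr
      obtain ⟨z, hz, rfl⟩ := Multiset.mem_map.1 hr
      simp only [Set.mem_preimage, hp] at hs ht ⊢
      exact mul_mem hs ht
    · intro s hs
      refine Subgroup.subset_closure ?_
      simpa [A] using ⟨s, hs, rfl⟩
  have hpow : ∀ w : W, w ^ 2 = 1 := fun w => by rw [pow_two]; exact hW w
  have : Group.FG W := ⟨⟨A, hA⟩⟩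
  have hfin : Finite W := CommGroup.finite_of_fg_isMulTorsion W fun w =>
    isOfFinOrder_iff_pow_eq_one.2 ⟨2, two_pos, hpow w⟩
  refine ⟨hfin, ?_⟩
  have hexp : Monoid.exponent W ∣ 2 := Monoid.exponent_dvd_of_forall_pow_eq_one hpow
  have hrank : Group.rank W ≤ S.ncard := by
    refine (Group.rank_le hA).trans (Finset.card_image_le.trans ?_)
    rw [Set.ncard_eq_toFinset_card S hS]
  exact Nat.le_of_dvd (by positivity) ((card_dvd_exponent_pow_rank W).trans
    ((pow_dvd_pow_of_dvd hexp _).trans (pow_dvd_pow 2 hrank)))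

end IsDirectProdOf

theorem exists_decomposition {T : Type u} (X : TwoValuedGroup T)
    (hc : X.Commutative) (hinv : X.Involutive) (hfg : X.FinitelyGenerated) :
    ∃ (T' : Type u) (X' : TwoValuedGroup T') (W : Type u) (iW : CommGroup W),
      X'.Commutative ∧ X'.Involutive ∧ X'.FinitelyGenerated ∧
      ¬ HasSingleValuedDirectFactor X' ∧
      @IsBooleanGroup W iW ∧ Finite W ∧
      @IsDirectProdOf T T' W iW X X' := by
  obtain ⟨S, hS, hgen⟩ := hfg
  let N : Set ℕ := {n | ∃ (T' : Type u) (X' : TwoValuedGroup T') (W : Type u) (iW : CommGroup W),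
    X'.Commutative ∧ X'.Involutive ∧ @IsBooleanGroup W iW ∧ @IsDirectProdOf T T' W iW X X' ∧
    Nat.card W = n}
  have hne : N.Nonempty :=
    ⟨_, T, X, PUnit, inferInstance, hc, hinv, fun _ => rfl, IsDirectProdOf.punit X, rfl⟩
  have hbdd : BddAbove N := by
    refine ⟨2 ^ S.ncard, ?_⟩
    rintro n ⟨T', X', W, iW, -, -, hW, hprod, rfl⟩
    exact (hprod.finite_and_card_le hW hS hgen).2
  obtain ⟨T', X', W, iW, hc', hinv', hW, hprod, hcard⟩ := Nat.sSup_mem hne hbdd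
  have hWfin := (hprod.finite_and_card_le hW hS hgen).1
  refine ⟨T', X', W, iW, hc', hinv', hprod.finitelyGenerated ⟨S, hS, hgen⟩, ?_, hW, hWfin, hprod⟩
  rintro ⟨T'', X'', W', iW', hc'', hinv'', hW', hnt, hprod'⟩
  have hbool : IsBooleanGroup (W' × W) := fun w => Prod.ext (hW' w.1) (hW w.2)
  have hprod'' := hprod.trans hprod'
  have hle : Nat.card (W' × W) ≤ sSup N :=
    le_csSup hbdd ⟨T'', X'', W' × W, inferInstance, hc'', hinv'', hbool, hprod'', rfl⟩
  have hfin' : Finite (W' × W) := (hprod''.finite_and_card_le hbool hS hgen).1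
  have hW'fin : Finite W' := Finite.of_surjective (Prod.fst : W' × W → W') Prod.fst_surjective
  rw [← hcard, Nat.card_prod] at hle
  have h1 : 1 < Nat.card W' := Finite.one_lt_card
  have h2 : 0 < Nat.card W := Nat.card_pos
  nlinarith

/-- **Proposition 6.2 (propos_rasch_iso).** Every finitely generated involutive
commutative two-valued group decomposes as a direct product of a finitely generated
involutive commutative two-valued group without single-valued direct factors and a
finite Boolean group; moreover such a decomposition is unique up to isomorphism:
if `X ≅ X₁ × W₁ ≅ X₂ × W₂` are two such decompositions then `X₁ ≅ X₂` and `W₁ ≅ W₂`. -/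
theorem direct_factor_decomposition {T : Type u} (X : TwoValuedGroup T)
    (hc : X.Commutative) (hinv : X.Involutive) (hfg : X.FinitelyGenerated) :
    (∃ (T' : Type u) (X' : TwoValuedGroup T') (W : Type u) (iW : CommGroup W),
      X'.Commutative ∧ X'.Involutive ∧ X'.FinitelyGenerated ∧
      ¬ HasSingleValuedDirectFactor X' ∧
      @IsBooleanGroup W iW ∧ Finite W ∧
      @IsDirectProdOf T T' W iW X X') ∧
    (∀ (T₁ : Type v) (T₂ : Type w) (X₁ : TwoValuedGroup T₁) (X₂ : TwoValuedGroup T₂)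
      (W₁ : Type v') (W₂ : Type w') (iW₁ : CommGroup W₁) (iW₂ : CommGroup W₂),
      X₁.Commutative → X₁.Involutive → X₁.FinitelyGenerated →
      ¬ HasSingleValuedDirectFactor X₁ →
      X₂.Commutative → X₂.Involutive → X₂.FinitelyGenerated →
      ¬ HasSingleValuedDirectFactor X₂ →
      @IsBooleanGroup W₁ iW₁ → @IsBooleanGroup W₂ iW₂ → Finite W₁ → Finite W₂ →
      @IsDirectProdOf T T₁ W₁ iW₁ X X₁ → @IsDirectProdOf T T₂ W₂ iW₂ X X₂ →
      Isomorphic X₁ X₂ ∧ @GroupIsomorphic W₁ W₂ iW₁ iW₂) := by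
  refine ⟨exists_decomposition X hc hinv hfg, ?_⟩
  intro T₁ T₂ X₁ X₂ W₁ W₂ _ _ hc₁ hinv₁ _ hX₁ hc₂ hinv₂ _ hX₂ hW₁ hW₂ _ _ hprod₁ hprod₂
  obtain ⟨φ, hφ⟩ := hprod₁.exists_isProdIso hprod₂
  exact hφ.isomorphic_and_groupIsomorphic hc₁ hinv₁ hX₁ hc₂ hinv₂ hX₂ hW₁ hW₂

end TwoValuedGroup
end

section
/- Let X be an involutive commutative two-valued group and let V ⊆ X be the subset consisting of the identity e and all elements of order 2. Then: (a) for every x ∈ V and every y ∈ X the multiset x*y consists of two equal elements, so the partial operation x·y (defined by x*y = [x·y, x·y]) is defined, and V is a Boolean group with respect to ·; (b) the operation · defines an action of the group V on the set X, and if x*y = [z₁,z₂] then (v·x)*y = [v·z₁, v·z₂] for all v ∈ V; (c) if v ∈ V∖{e} and x ∈ X, then v·x = x if and only if x² = v; in particular, v·x = x is possible only if ord x = 4. -/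
/-!
Two-valued groups after V.M. Buchstaber, A.P. Veselov and A.A. Gaifullin.

`X.mul x y` is the two-element multiset `x * y`.
-/

universe u v w u' v' w'

namespace TwoValuedGroup

/-- A product with an element of order at most two, multiplied by the same element again,
returns the original element. -/
lemma mul_eq_pair_of_mem_mul {T : Type u} (X : TwoValuedGroup T) {x y a b : T}
    (hx : X.mul x x = {X.e, X.e}) (hxy : X.mul x y = {a, b}) :
    X.mul x a = {y, y} ∧ X.mul x b = {y, y} := by
  have h := X.assoc x x y
  simp only [hx, hxy, Multiset.insert_eq_cons, Multiset.cons_bind,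
    Multiset.singleton_bind, X.e_mul] at h
  have hall : ∀ t ∈ X.mul x a + X.mul x b, t = y := by
    rw [← h]; simp
  exact ⟨Multiset.eq_replicate.2 ⟨X.card_mul x a, fun t ht =>
      hall t (Multiset.mem_add.2 (Or.inl ht))⟩,
    Multiset.eq_replicate.2 ⟨X.card_mul x b, fun t ht =>
      hall t (Multiset.mem_add.2 (Or.inr ht))⟩⟩

/-- Two multisets with equal doubles are equal. -/
lemma multiset_eq_of_add_self_eq {T : Type u} {s t : Multiset T} (h : s + s = t + t) :
    s = t := by
  classical
  ext a
  have := congrArg (Multiset.count a) h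
  simp only [Multiset.count_add] at this
  omega

/-- In an involutive two-valued group, two elements whose product contains the
identity coincide. -/
lemma Involutive.eq_of_e_mem_mul {T : Type u} {X : TwoValuedGroup T} (hinv : X.Involutive)
    {a b : T} (h : X.e ∈ X.mul a b) : a = b :=
  ((X.inv_unique a b (Or.inl h)).trans (hinv a)).symm

/-- Every square in an involutive two-valued group contains the identity. -/
lemma Involutive.exists_mul_self {T : Type u} {X : TwoValuedGroup T} (hinv : X.Involutive)
    (x : T) : ∃ q, X.mul x x = {X.e, q} := by
  obtain ⟨p, q, hpq⟩ := Multiset.card_eq_two.1 (X.card_mul x x)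
  have h := X.e_mem_mul_inv x
  rw [hinv x, hpq] at h
  rcases Multiset.mem_cons.1 h with h | h
  · exact ⟨q, by rw [hpq, h]⟩
  · exact ⟨p, by rw [hpq, ← Multiset.mem_singleton.1 h, Multiset.pair_comm]⟩

/-- Products with an element of order at most two are doubled. -/
lemma exists_mul_eq_pair {T : Type u} (X : TwoValuedGroup T)
    (hc : X.Commutative) (hinv : X.Involutive) {x : T} (hx : X.mul x x = {X.e, X.e}) (y : T) :
    ∃ z, X.mul x y = {z, z} := by
  obtain ⟨a, b, hab⟩ := Multiset.card_eq_two.1 (X.card_mul x y)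
  obtain ⟨hxa, hxb⟩ := X.mul_eq_pair_of_mem_mul hx hab
  obtain ⟨q, hq⟩ := hinv.exists_mul_self y
  obtain ⟨a₂, ha⟩ := hinv.exists_mul_self a
  suffices hmem : X.e ∈ X.mul a b by
    obtain rfl := hinv.eq_of_e_mem_mul hmem
    exact ⟨a, hab⟩
  by_contra hmem
  have key : ∀ c, X.mul x c = {y, y} →
      X.mul a c + X.mul b c = {X.e, q} + {X.e, q} := by
    intro c hxc
    have h := X.assoc y x c
    simpa only [hc y x, hab, hxc, Multiset.insert_eq_cons, Multiset.cons_bind,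
      Multiset.singleton_bind, hq] using h
  -- if `e ∉ a * b`, then `a` has order at most two, hence so does `y`
  have haa : X.mul a a = {X.e, X.e} := by
    classical
    have h := congrArg (Multiset.count X.e) (key a hxa)
    rw [hc b a, Multiset.count_add, Multiset.count_eq_zero_of_notMem hmem, ha] at h
    have : X.e = a₂ := by
      by_contra hne
      simp [Multiset.count_cons, Multiset.count_singleton, hne] at h
    rw [ha, ← this]
  have hay : X.mul a y = {x, x} := (X.mul_eq_pair_of_mem_mul haa ((hc a x).trans hxa)).1
  have hqe : q = X.e := by
    have h := X.assoc x a y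
    simp only [hxa, hay, Multiset.insert_eq_cons, Multiset.cons_bind,
      Multiset.singleton_bind, hq, hx] at h
    have hmq : q ∈ ({X.e, X.e} : Multiset T) + {X.e, X.e} := by
      simp only [Multiset.insert_eq_cons]
      rw [← h]; simp
    simpa using hmq
  obtain ⟨c, hcm⟩ := Multiset.card_pos_iff_exists_mem.1
    (by rw [X.card_mul a b]; norm_num : 0 < Multiset.card (X.mul a b))
  have hce : c ∈ X.mul a b + X.mul b b := Multiset.mem_add.2 (Or.inl hcm)
  rw [key b hxb, hqe] at hce
  have : c = X.e := by simpa using hce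
  exact hmem (this ▸ hcm)

/-- Multiplication by an element all of whose products are doubled passes through products. -/
lemma mul_eq_pair_of_doubled {T : Type u} (X : TwoValuedGroup T) {m : T → T → T} {v : T}
    (hv : ∀ y, X.mul v y = {m v y, m v y}) {x y z₁ z₂ : T} (hxy : X.mul x y = {z₁, z₂}) :
    X.mul (m v x) y = {m v z₁, m v z₂} := by
  apply multiset_eq_of_add_self_eq
  have h := X.assoc v x y
  simp only [hxy, hv, Multiset.insert_eq_cons, Multiset.cons_bind,
    Multiset.singleton_bind] at h
  rw [h]
  classical
  ext t
  simp only [Multiset.insert_eq_cons, Multiset.count_add, Multiset.count_cons,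
    Multiset.count_singleton]
  omega

/-- Cancellation of the common first element in an unordered pair. -/
lemma multiset_pair_right_cancel {T : Type u} {a b c : T}
    (h : ({a, b} : Multiset T) = {a, c}) : b = c :=
  Multiset.singleton_inj.1 ((Multiset.cons_inj_right a).1 h)

/-- An element with a nontrivial square that fixes it has order four. -/
lemma IsPowFamily.ordOf_eq_four {T : Type u} {X : TwoValuedGroup T} {P : T → ℤ → T}
    (hP : X.IsPowFamily P) {x : T} (hne : P x 2 ≠ X.e) (hfix : X.mul x (P x 2) = {x, x}) :
    X.ordOf P x = 4 := by
  obtain ⟨h0, h1, -, hs⟩ := hP x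
  have s1 : X.mul x x = {X.e, P x 2} := by simpa [h0, h1] using hs 1 le_rfl
  have s2 : X.mul x (P x 2) = {x, P x 3} := by simpa [h1] using hs 2 (by norm_num)
  have h3 : P x 3 = x := (multiset_pair_right_cancel (hfix.symm.trans s2)).symm
  have s3 : X.mul x x = {P x 2, P x 4} := by simpa [h3] using hs 3 (by norm_num)
  have h4 : P x 4 = X.e := by
    rw [s1, Multiset.pair_comm] at s3
    exact (multiset_pair_right_cancel s3).symm
  have hxe : x ≠ X.e := by
    intro hxe
    rw [hxe, X.e_mul] at s1
    exact hne (hxe ▸ (multiset_pair_right_cancel s1).symm)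
  refine le_antisymm (Nat.sInf_le ⟨by norm_num, h4⟩)
    (le_csInf ⟨4, by norm_num, h4⟩ ?_)
  rintro n ⟨hn, hne'⟩
  by_contra hlt
  have : n = 1 ∨ n = 2 ∨ n = 3 := by omega
  rcases this with rfl | rfl | rfl
  · exact hxe (h1.symm.trans hne')
  · exact hne hne'
  · exact hxe (h3.symm.trans hne')

/-- **Proposition 3.2 (propos_bullet).** Let `X` be an involutive commutative two-valued
group and `V = {x | x² = e}` the set consisting of the identity and the elements of order
`2` (i.e. `P x 2 = e`, where `P` is the power family). Then there is a (partial, here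
totalized) single-valued operation `m` with:
(a) for `x ∈ V` the multiset `x * y` is `[m x y, m x y]`, and `V` is a Boolean group
under `m`;
(b) `m` defines an action of `V` on `X`, and if `x * y = [z₁, z₂]` then
`(v·x) * y = [v·z₁, v·z₂]` for `v ∈ V`;
(c) for `v ∈ V \ {e}`, `v·x = x` iff `x² = v`; in particular this forces `ord x = 4`. -/
theorem order_two_boolean_action {T : Type u} (X : TwoValuedGroup T)
    (hc : X.Commutative) (hinv : X.Involutive)
    (P : T → ℤ → T) (hP : X.IsPowFamily P) :
    ∃ m : T → T → T,
      -- (a) doubled products with elements of V, and the Boolean group structure on V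
      (∀ x, P x 2 = X.e → ∀ y : T, X.mul x y = {m x y, m x y}) ∧
      (∀ x y, P x 2 = X.e → P y 2 = X.e → P (m x y) 2 = X.e) ∧
      (∀ x y, P x 2 = X.e → P y 2 = X.e → m x y = m y x) ∧
      (∀ x y z, P x 2 = X.e → P y 2 = X.e → P z 2 = X.e → m (m x y) z = m x (m y z)) ∧
      (∀ x, P x 2 = X.e → m x x = X.e) ∧
      -- (b) action of V on X compatible with the two-valued multiplication
      (∀ y : T, m X.e y = y) ∧
      (∀ v w, P v 2 = X.e → P w 2 = X.e → ∀ y : T, m v (m w y) = m (m v w) y) ∧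
      (∀ v, P v 2 = X.e → ∀ x y z₁ z₂ : T, X.mul x y = {z₁, z₂} →
        X.mul (m v x) y = {m v z₁, m v z₂}) ∧
      -- (c) fixed points of the action
      (∀ v, P v 2 = X.e → v ≠ X.e → ∀ x : T,
        (m v x = x ↔ P x 2 = v) ∧ (m v x = x → X.ordOf P x = 4)) := by
  have hsq : ∀ x, X.mul x x = {X.e, P x 2} := fun x => by
    obtain ⟨h0, h1, -, hs⟩ := hP x
    simpa [h0, h1] using hs 1 le_rfl
  have hV : ∀ {x}, P x 2 = X.e → X.mul x x = {X.e, X.e} := fun {x} hx => by rw [hsq x, hx]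
  have hmem : ∀ x y, ∃ z, z ∈ X.mul x y := fun x y =>
    Multiset.card_pos_iff_exists_mem.1 (by rw [X.card_mul x y]; norm_num)
  choose m hm using hmem
  have hm_eq : ∀ {x y z}, X.mul x y = {z, z} → m x y = z := fun {x y z} h => by
    have := hm x y
    rw [h] at this
    simpa using this
  have hdbl : ∀ x, P x 2 = X.e → ∀ y, X.mul x y = {m x y, m x y} := by
    intro x hx y
    obtain ⟨z, hz⟩ := X.exists_mul_eq_pair hc hinv (hV hx) y
    rw [hm_eq hz, hz]
  have hmul : ∀ v, P v 2 = X.e → ∀ x y z₁ z₂ : T, X.mul x y = {z₁, z₂} →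
      X.mul (m v x) y = {m v z₁, m v z₂} := fun v hv _ _ _ _ h =>
    X.mul_eq_pair_of_doubled (hdbl v hv) h
  have hme : ∀ x, m x X.e = x := fun x => hm_eq (X.mul_e x)
  have hself : ∀ x, P x 2 = X.e → m x x = X.e := fun x hx => hm_eq (hV hx)
  have hact : ∀ v w, P v 2 = X.e → P w 2 = X.e → ∀ y : T, m v (m w y) = m (m v w) y :=
    fun v w hv hw y => (hm_eq (hmul v hv w y _ _ (hdbl w hw y))).symm
  have hcomm : ∀ x y, P x 2 = X.e → P y 2 = X.e → m x y = m y x := fun x y _ hy =>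
    hm_eq ((hc x y).trans (hdbl y hy x))
  refine ⟨m, hdbl, ?_, hcomm, fun x y z hx hy _ => (hact x y hx hy z).symm, hself,
    fun y => hm_eq (X.e_mul y), hact, hmul, ?_⟩
  · intro x y hx hy
    have h₁ : X.mul y (m x y) = {x, x} := by
      rw [hc, hmul x hx y y _ _ (hV hy), hme]
    have h₂ := hmul x hx _ _ _ _ h₁
    rw [hself x hx, hsq] at h₂
    exact multiset_pair_right_cancel h₂
  · intro v hv hne x
    have hmx : X.mul (m v x) x = {v, m v (P x 2)} := by
      simpa only [hme] using hmul v hv _ _ _ _ (hsq x)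
    have hiff : m v x = x ↔ P x 2 = v := by
      constructor
      · intro h
        rw [h, hsq x] at hmx
        have hvm : v ∈ ({X.e, P x 2} : Multiset T) := by rw [hmx]; simp
        have : v = X.e ∨ v = P x 2 := by simpa using hvm
        exact (this.resolve_left hne).symm
      · intro h
        apply hinv.eq_of_e_mem_mul
        rw [hmx, h, hself v hv]
        simp
    refine ⟨hiff, fun h => ?_⟩
    have h2 := hiff.1 h
    apply hP.ordOf_eq_four
    · rwa [h2]
    · rw [h2, hc, hdbl v hv, h]

end TwoValuedGroup
end

section
/- Let X be a special involutive commutative two-valued group. Then: (a) every element of X has order 1, 2 or 4; (b) all elements of order 4 in X have the same square, i.e. there exists an element s ∈ X such that x² = s for every element x ∈ X of order 4. -/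
/-!
Two-valued groups after V.M. Buchstaber, A.P. Veselov and A.A. Gaifullin.

`X.mul x y` is the two-element multiset `x * y`.
-/

universe u v w u' v' w'

namespace TwoValuedGroup

section Multisets

variable {T : Type u}

theorem eq_pair_self_of_forall_mem {M : Multiset T} {a : T} (hM : Multiset.card M = 2)
    (h : ∀ p ∈ M, p = a) : M = {a, a} :=
  Multiset.eq_replicate.2 ⟨hM, h⟩

theorem eq_pair_of_mem {M : Multiset T} {a b : T} (hM : Multiset.card M = 2)
    (ha : a ∈ M) (hb : b ∈ M) (hab : a ≠ b) : M = {a, b} := by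
  obtain ⟨p, q, rfl⟩ := Multiset.card_eq_two.1 hM
  simp only [Multiset.insert_eq_cons, Multiset.mem_cons, Multiset.mem_singleton] at ha hb
  rcases ha with rfl | rfl <;> rcases hb with rfl | rfl <;>
    first | exact absurd rfl hab | rfl | exact Multiset.pair_comm _ _

theorem exists_pair_of_mem {M : Multiset T} {a : T} (hM : Multiset.card M = 2) (ha : a ∈ M) :
    ∃ b, M = {a, b} := by
  obtain ⟨N, rfl⟩ := Multiset.exists_cons_of_mem ha
  rw [Multiset.card_cons] at hM
  obtain ⟨b, rfl⟩ := Multiset.card_eq_one.1 (show Multiset.card N = 1 by omega)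
  exact ⟨b, rfl⟩

theorem add_self_injective : Function.Injective (fun M : Multiset T => M + M) := by
  classical
  intro M N h
  ext t
  have := congrArg (Multiset.count t) h
  simp only [Multiset.count_add] at this
  omega

theorem pair_right_injective {a b c : T} (h : ({a, b} : Multiset T) = {a, c}) : b = c := by
  simpa [Multiset.insert_eq_cons] using h

end Multisets

section Involutive

variable {T : Type u} {X : TwoValuedGroup T} {a b c d s t x y z w v q : T}

theorem mem_pair {a b c : T} : a ∈ ({b, c} : Multiset T) ↔ a = b ∨ a = c := by
  simp [Multiset.insert_eq_cons]

theorem e_mem_mul_iff (hinv : X.Involutive) : X.e ∈ X.mul x y ↔ x = y := by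
  constructor
  · intro h
    rw [X.inv_unique x y (Or.inl h), hinv]
  · rintro rfl
    simpa only [hinv x] using X.e_mem_mul_inv x

/-- Associativity in terms of chosen enumerations of the inner products. -/
theorem add_eq_add (X : TwoValuedGroup T) (hxy : X.mul x y = {a, b}) (hyz : X.mul y z = {c, d}) :
    X.mul a z + X.mul b z = X.mul x c + X.mul x d := by
  have h := X.assoc x y z
  rw [hxy, hyz] at h
  simpa [Multiset.insert_eq_cons] using h

theorem mem_mul_rotate (hinv : X.Involutive) (h : z ∈ X.mul x y) : x ∈ X.mul y z := by
  have h₁ : X.e ∈ (X.mul x y).bind (fun t => X.mul t z) :=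
    Multiset.mem_bind.2 ⟨z, h, (e_mem_mul_iff hinv).2 rfl⟩
  rw [X.assoc] at h₁
  obtain ⟨t, ht, hxt⟩ := Multiset.mem_bind.1 h₁
  rwa [(e_mem_mul_iff hinv).1 hxt]

/-- `x * x = [e, e]`, that is, the order of `x` is at most two. -/
def IsTwoTorsion (X : TwoValuedGroup T) (x : T) : Prop := X.mul x x = {X.e, X.e}

theorem isTwoTorsion_e : X.IsTwoTorsion X.e := X.e_mul X.e

theorem exists_mem_mul (X : TwoValuedGroup T) (x y : T) : ∃ z, z ∈ X.mul x y :=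
  Multiset.card_pos_iff_exists_mem.1 (by rw [X.card_mul]; norm_num)

/-- A chosen element of `t * x`; when `t` is two-torsion it is the only one. -/
noncomputable def act (X : TwoValuedGroup T) (t x : T) : T := (X.exists_mem_mul t x).choose

theorem act_eq_of_mul (h : X.mul t x = {y, y}) : X.act t x = y := by
  have : X.act t x ∈ X.mul t x := (X.exists_mem_mul t x).choose_spec
  rw [h, mem_pair, or_self] at this
  exact this

theorem IsTwoTorsion.exists_mul_eq (ht : X.IsTwoTorsion t) (x : T) :
    ∃ p, X.mul t x = {p, p} ∧ X.mul t p = {x, x} := by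
  obtain ⟨p, q, hpq⟩ := Multiset.card_eq_two.1 (X.card_mul t x)
  have h₁ := X.add_eq_add ht hpq
  have hp : X.mul t p = {x, x} := by
    refine eq_pair_self_of_forall_mem (X.card_mul t p) fun r hr => ?_
    have : r ∈ X.mul t p + X.mul t q := Multiset.mem_add.2 (Or.inl hr)
    rw [← h₁, X.e_mul, Multiset.mem_add, or_self, mem_pair, or_self] at this
    exact this
  have h₂ := X.add_eq_add ht hp
  have hq : q ∈ X.mul t x + X.mul t x := by
    rw [hpq]; simp [Multiset.insert_eq_cons]
  rw [← h₂, X.e_mul, Multiset.mem_add, or_self, mem_pair, or_self] at hq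
  exact ⟨p, by rw [hpq, hq], hp⟩

theorem IsTwoTorsion.mul_eq (ht : X.IsTwoTorsion t) (x : T) :
    X.mul t x = {X.act t x, X.act t x} := by
  obtain ⟨p, hp, -⟩ := ht.exists_mul_eq x
  rw [act_eq_of_mul hp, hp]

theorem IsTwoTorsion.act_act (ht : X.IsTwoTorsion t) (x : T) : X.act t (X.act t x) = x := by
  obtain ⟨p, hp, hp'⟩ := ht.exists_mul_eq x
  rw [act_eq_of_mul hp, act_eq_of_mul hp']

theorem act_e (X : TwoValuedGroup T) (t : T) : X.act t X.e = t := act_eq_of_mul (X.mul_e t)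

theorem IsTwoTorsion.act_mul (ht : X.IsTwoTorsion t) (x y : T) :
    X.mul (X.act t x) y = (X.mul x y).map (X.act t) := by
  obtain ⟨a, b, hab⟩ := Multiset.card_eq_two.1 (X.card_mul x y)
  have h := X.add_eq_add (ht.mul_eq x) hab
  rw [ht.mul_eq a, ht.mul_eq b] at h
  apply add_self_injective
  simp only [h, hab, Multiset.insert_eq_cons, Multiset.map_cons, Multiset.map_singleton]
  simp only [← Multiset.singleton_add]
  abel

theorem IsTwoTorsion.mul_act (ht : X.IsTwoTorsion t) (hc : X.Commutative) (x y : T) :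
    X.mul x (X.act t y) = (X.mul x y).map (X.act t) := by
  rw [hc, ht.act_mul, hc]

theorem IsTwoTorsion.mul_act_self (ht : X.IsTwoTorsion t) (hc : X.Commutative) (x : T) :
    X.mul (X.act t x) (X.act t x) = X.mul x x := by
  rw [ht.act_mul, ht.mul_act hc, Multiset.map_map]
  simp only [Function.comp_def, ht.act_act, Multiset.map_id']

theorem IsTwoTorsion.act (ht : X.IsTwoTorsion t) (hc : X.Commutative) (hx : X.IsTwoTorsion x) :
    X.IsTwoTorsion (X.act t x) :=
  (ht.mul_act_self hc x).trans hx

theorem isTwoTorsion_iff {p : T} (hp : X.mul x x = {X.e, p}) : X.IsTwoTorsion x ↔ p = X.e := by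
  constructor
  · intro h
    exact pair_right_injective (hp.symm.trans h)
  · rintro rfl
    exact hp

/-- An element `p ≠ e` stabilizing `y` is the square of `y` and is two-torsion. -/
theorem eq_square_of_mul_eq_self {p p' : T} (hsq : X.mul y y = {X.e, p'}) (hp : p ≠ X.e)
    (h : X.mul p y = {y, y}) : p = p' ∧ X.IsTwoTorsion p := by
  have h₁ := X.add_eq_add h hsq
  rw [X.mul_e, hsq] at h₁
  have hpp : p = p' := by
    have : p ∈ ({X.e, p'} : Multiset T) + {X.e, p'} := by
      rw [h₁]; simp [Multiset.insert_eq_cons]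
    rw [Multiset.mem_add, or_self, mem_pair] at this
    exact this.resolve_left hp
  subst hpp
  refine ⟨rfl, ?_⟩
  have h₂ : ({p, p} : Multiset T) + X.mul p p = {p, p} + {X.e, X.e} := by
    rw [← h₁]
    simp only [Multiset.insert_eq_cons, ← Multiset.singleton_add]
    abel
  exact add_left_cancel h₂

theorem mul_eq_pair_self_rotate (hinv : X.Involutive) (hx : ¬ X.IsTwoTorsion x)
    (h : X.mul x y = {z, z}) : X.mul y z = {x, x} := by
  have hxm : x ∈ X.mul y z := mem_mul_rotate hinv (by rw [h]; simp [Multiset.insert_eq_cons])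
  obtain ⟨p, hp⟩ := exists_pair_of_mem (X.card_mul y z) hxm
  by_cases hpx : p = x
  · rw [hp, hpx]
  exfalso
  obtain ⟨g, hg⟩ := exists_pair_of_mem (X.card_mul x x) ((e_mem_mul_iff hinv).2 rfl)
  obtain ⟨k, hk⟩ := exists_pair_of_mem (X.card_mul z z) ((e_mem_mul_iff hinv).2 rfl)
  have h₁ := X.add_eq_add h hp
  have hep : X.e ∉ X.mul x p := fun he => hpx ((e_mem_mul_iff hinv).1 he).symm
  have hge : X.e ≠ g := fun he => hx (hg.trans (by rw [← he]))
  classical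
  have h₂ := congrArg (Multiset.count X.e) h₁
  rw [hg, hk] at h₂
  simp only [Multiset.count_add, Multiset.count_eq_zero_of_notMem hep, Multiset.insert_eq_cons,
    Multiset.count_cons, Multiset.count_singleton, if_neg hge, if_true] at h₂
  omega

/-- In `x * y = [z, z]` with `ord x > 2` the elements `x` and `z` have the same square. -/
theorem mul_self_eq_of_mul_eq_pair_self (hinv : X.Involutive) (hx : ¬ X.IsTwoTorsion x)
    (h : X.mul x y = {z, z}) : X.mul z z = X.mul x x :=
  add_self_injective (X.add_eq_add h (mul_eq_pair_self_rotate hinv hx h))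

/-- Both members of a special pair have the same square, and this square is two-torsion. -/
theorem square_eq_of_mul_eq_pair_self (hc : X.Commutative) (hinv : X.Involutive)
    {p p' : T} (hp : X.mul x x = {X.e, p}) (hp' : X.mul y y = {X.e, p'})
    (hx : ¬ X.IsTwoTorsion x) (hy : ¬ X.IsTwoTorsion y) (h : X.mul x y = {z, z}) :
    p = p' ∧ X.IsTwoTorsion p := by
  have hxz : X.mul x z = {y, y} := mul_eq_pair_self_rotate hinv hy (by rw [hc, h])
  refine eq_square_of_mul_eq_self hp' (fun he => hx ((isTwoTorsion_iff hp).2 he)) ?_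
  have h₁ := X.add_eq_add hp h
  rw [X.e_mul, hxz] at h₁
  exact add_left_cancel h₁

theorem IsTwoTorsion.act_eq_of_square (hinv : X.Involutive)
    (hs : X.IsTwoTorsion s) (hx : X.mul x x = {X.e, s}) : X.act s x = x := by
  have h : x ∈ X.mul s x :=
    mem_mul_rotate hinv (mem_mul_rotate hinv (by rw [hx]; exact mem_pair.2 (Or.inr rfl)))
  rw [hs.mul_eq, mem_pair, or_self] at h
  exact h.symm

/-- If `x² = s` is two-torsion while `w² ≠ s`, then `w * x = [a, s a]` with `s a ≠ a`, and the
square of `a` is that of `w` up to the action of `s`. -/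
theorem exists_mul_eq_act (hc : X.Commutative) (hinv : X.Involutive) {sq : T → T}
    (hsq : ∀ x, X.mul x x = {X.e, sq x}) (hx : ¬ X.IsTwoTorsion x) (hw : ¬ X.IsTwoTorsion w)
    (hs : X.IsTwoTorsion (sq x)) (hwx : sq w ≠ sq x) :
    ∃ a, X.mul w x = {a, X.act (sq x) a} ∧ a ≠ X.act (sq x) a ∧ ¬ X.IsTwoTorsion a ∧
      (sq a = sq w ∨ sq a = X.act (sq x) (sq w)) := by
  have hse : sq x ≠ X.e := fun he => hx ((isTwoTorsion_iff (hsq x)).2 he)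
  have hsx : X.act (sq x) x = x := hs.act_eq_of_square hinv (hsq x)
  have hww : w ≠ X.act (sq x) w := fun h =>
    hwx (eq_square_of_mul_eq_self (hsq w) hse (by rw [hs.mul_eq, ← h])).1.symm
  obtain ⟨a, b, hab⟩ := Multiset.card_eq_two.1 (X.card_mul w x)
  have hne : a ≠ b := by
    rintro rfl
    exact hwx (square_eq_of_mul_eq_pair_self hc hinv (hsq w) (hsq x) hw hx hab).1
  have hmap : (X.mul w x).map (X.act (sq x)) = X.mul w x := by
    rw [← hs.mul_act hc, hsx]
  have hwa : w ∈ X.mul x a := mem_mul_rotate hinv (by rw [hab]; exact mem_pair.2 (Or.inl rfl))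
  have hwa' : X.act (sq x) w ∈ X.mul x a :=
    mem_mul_rotate hinv (by rw [hs.act_mul, hmap, hab]; exact mem_pair.2 (Or.inl rfl))
  have hxa : X.mul x a = {w, X.act (sq x) w} := eq_pair_of_mem (X.card_mul x a) hwa hwa' hww
  have ha : ¬ X.IsTwoTorsion a := by
    intro ha
    rw [hc, ha.mul_eq, mem_pair, or_self] at hwa hwa'
    exact hww (hwa.trans hwa'.symm)
  have hsa : X.act (sq x) a ≠ a := by
    intro hsa
    have hsqa := (eq_square_of_mul_eq_self (hsq a) hse (by rw [hs.mul_eq, hsa])).1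
    have h₁ := X.add_eq_add hxa (hsq a)
    have hwax : X.mul w a = {x, x} := by
      refine eq_pair_self_of_forall_mem (X.card_mul w a) fun r hr => ?_
      have : r ∈ X.mul w a + X.mul (X.act (sq x) w) a := Multiset.mem_add.2 (Or.inl hr)
      rw [h₁, ← hsqa, X.mul_e, hc x (sq x), hs.mul_eq, hsx, Multiset.mem_add, or_self, mem_pair,
        or_self] at this
      exact this
    exact hwx ((square_eq_of_mul_eq_pair_self hc hinv (hsq w) (hsq a) hw ha hwax).1.trans
      hsqa.symm)
  have hb : X.act (sq x) a = b := by
    have : X.act (sq x) a ∈ X.mul w x := by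
      rw [← hmap, hab]
      exact Multiset.mem_map_of_mem _ (mem_pair.2 (Or.inl rfl))
    rw [hab, mem_pair] at this
    exact this.resolve_left hsa
  refine ⟨a, by rw [hab, hb], hsa.symm, ha, ?_⟩
  have h₁ := X.add_eq_add hab hxa
  rw [← hb, hs.act_mul, hs.mul_act hc, hsq a, hsq w] at h₁
  simp only [Multiset.insert_eq_cons, Multiset.map_cons, Multiset.map_singleton, X.act_e] at h₁
  have h₂ : ({sq a, X.act (sq x) (sq a)} : Multiset T) = {sq w, X.act (sq x) (sq w)} := by
    apply add_left_cancel (a := ({X.e, sq x} : Multiset T))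
    simp only [Multiset.insert_eq_cons, ← Multiset.singleton_add] at h₁ ⊢
    rw [add_add_add_comm] at h₁
    rw [h₁]
    abel
  have : sq a ∈ ({sq a, X.act (sq x) (sq a)} : Multiset T) := mem_pair.2 (Or.inl rfl)
  rwa [h₂, mem_pair] at this

/-- The partners `a` and `c` of `w` along two members of a special triple differ by the third. -/
theorem mul_eq_of_special_triple (hc : X.Commutative) (hs : X.IsTwoTorsion s)
    (hsz : X.act s z = z) (hzx : X.mul z x = {y, y})
    (ha : X.mul w x = {a, X.act s a}) (hcy : X.mul w y = {c, X.act s c}) :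
    X.mul z a = {c, X.act s c} := by
  have h := X.add_eq_add hzx (by rw [hc, ha] : X.mul x w = {a, X.act s a})
  rw [hs.mul_act hc, ← hs.act_mul, hsz, hc y w, hcy] at h
  exact (add_self_injective h).symm

theorem exists_mul_eq_third (hinv : X.Involutive)
    (hza : X.mul z a = {c, X.act s c}) : ∃ q, X.mul a c = {z, q} :=
  exists_pair_of_mem (X.card_mul a c)
    (mem_mul_rotate hinv (by rw [hza]; exact mem_pair.2 (Or.inl rfl)))

theorem cons_mul_eq_cons_mul (hc : X.Commutative) (ha : X.mul a a = {X.e, v})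
    (hza : X.mul z a = {c, d}) (hac : X.mul a c = {z, q}) :
    c ::ₘ X.mul v c = d ::ₘ X.mul a q := by
  have h := X.add_eq_add ha hac
  rw [X.e_mul, hc a z, hza] at h
  simpa [Multiset.insert_eq_cons] using h

/-- If the partners `a` and `c` have a common square `v ≠ s`, then `s v = v`. -/
theorem act_square_eq (hc : X.Commutative) (hinv : X.Involutive) (hs : X.IsTwoTorsion s)
    (ha : X.mul a a = {X.e, v}) (hcv : X.mul c c = {X.e, v})
    (hcs : c ≠ X.act s c) (hvs : v ≠ s) (hza : X.mul z a = {c, X.act s c}) :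
    X.act s v = v := by
  obtain ⟨q, hac⟩ := exists_mul_eq_third hinv hza
  have h := cons_mul_eq_cons_mul hc ha hza hac
  have hm : X.act s c ∈ X.mul v c := by
    have : X.act s c ∈ c ::ₘ X.mul v c := by rw [h]; exact Multiset.mem_cons_self _ _
    exact (Multiset.mem_cons.1 this).resolve_left hcs.symm
  have hm' : v ∈ X.mul c (X.act s c) := mem_mul_rotate hinv hm
  rw [hs.mul_act hc, hcv] at hm'
  simp only [Multiset.insert_eq_cons, Multiset.map_cons, Multiset.map_singleton, X.act_e,
    Multiset.mem_cons, Multiset.mem_singleton] at hm'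
  exact (hm'.resolve_left hvs).symm

/-- If moreover `s v = v`, then `v = q z` for some two-torsion element `q`. -/
theorem exists_isTwoTorsion_act_eq (hc : X.Commutative) (hinv : X.Involutive) {sq : T → T}
    (hsq : ∀ x, X.mul x x = {X.e, sq x}) (hs : X.IsTwoTorsion s)
    (hat : ¬ X.IsTwoTorsion a) (hac' : sq a = sq c) (hcs : c ≠ X.act s c)
    (hv : X.act s (sq a) = sq a) (hza : X.mul z a = {c, X.act s c}) :
    ∃ q, X.IsTwoTorsion q ∧ X.act q (sq a) = z := by
  obtain ⟨q, hac⟩ := exists_mul_eq_third hinv hza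
  have h := cons_mul_eq_cons_mul hc (hsq a) hza hac
  have hm : X.act s c ∈ X.mul (sq a) c := by
    have : X.act s c ∈ c ::ₘ X.mul (sq a) c := by rw [h]; exact Multiset.mem_cons_self _ _
    exact (Multiset.mem_cons.1 this).resolve_left hcs.symm
  have hm' : c ∈ X.mul (sq a) c := by
    have := Multiset.mem_map_of_mem (X.act s) hm
    rwa [hs.act_act, ← hs.act_mul, hv] at this
  have hvc : X.mul (sq a) c = {X.act s c, c} := eq_pair_of_mem (X.card_mul _ _) hm hm' hcs.symm
  have haq : X.mul a q = {c, c} := by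
    rw [hvc, Multiset.insert_eq_cons, Multiset.cons_swap] at h
    exact ((Multiset.cons_inj_right _).1 h).symm
  have hqz : q ≠ z := by
    rintro rfl
    rw [hc, hza] at haq
    exact hcs (pair_right_injective haq).symm
  have h₁ := X.add_eq_add (by rw [hc, haq] : X.mul q a = {c, c}) hac
  rw [hsq c, ← hac', hsq q] at h₁
  have hq : sq q = X.e := by
    have heq : X.e ∉ X.mul q z := fun he => hqz ((e_mem_mul_iff hinv).1 he)
    by_contra hne
    classical
    have h₂ := congrArg (Multiset.count X.e) h₁
    simp only [Multiset.count_add, Multiset.count_eq_zero_of_notMem heq, Multiset.insert_eq_cons,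
      Multiset.count_cons, Multiset.count_singleton, if_neg (Ne.symm hne), if_true] at h₂
    omega
  have hqt : X.IsTwoTorsion q := (isTwoTorsion_iff (hsq q)).2 hq
  have hv : sq a ∈ X.mul q z := by
    have : sq a ∈ X.mul q z + {X.e, sq q} := by
      rw [← h₁]; simp [Multiset.insert_eq_cons]
    rw [Multiset.mem_add, hq, mem_pair, or_self] at this
    exact this.resolve_right fun he => hat ((isTwoTorsion_iff (hsq a)).2 he)
  rw [hqt.mul_eq, mem_pair, or_self] at hv
  exact ⟨q, hqt, by rw [hv, hqt.act_act]⟩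

/-- In the presence of a special pair, all elements of order greater than two have the same
square. -/
theorem square_eq_of_special (hc : X.Commutative) (hinv : X.Involutive) {sq : T → T}
    (hsq : ∀ x, X.mul x x = {X.e, sq x}) (hx : ¬ X.IsTwoTorsion x) (hy : ¬ X.IsTwoTorsion y)
    (hxy : X.mul x y = {z, z}) (hw : ¬ X.IsTwoTorsion w) : sq w = sq x := by
  by_contra hwx
  obtain ⟨hsxy, hs⟩ := square_eq_of_mul_eq_pair_self hc hinv (hsq x) (hsq y) hx hy hxy
  have hyz : X.mul y z = {x, x} := mul_eq_pair_self_rotate hinv hx hxy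
  have hzx : X.mul z x = {y, y} := by
    rw [hc]
    exact mul_eq_pair_self_rotate hinv hy (by rw [hc, hxy])
  have hzz : X.mul z z = X.mul x x := mul_self_eq_of_mul_eq_pair_self hinv hx hxy
  have hz : ¬ X.IsTwoTorsion z := fun h => hx (hzz.symm.trans h)
  have hsxz : sq x = sq z := pair_right_injective ((hsq x).symm.trans (hzz.symm.trans (hsq z)))
  obtain ⟨a, ha, has, hat, hasq⟩ := exists_mul_eq_act hc hinv hsq hx hw hs hwx
  obtain ⟨b, hb, hbs, hbt, hbsq⟩ :=
    exists_mul_eq_act hc hinv hsq hy hw (hsxy ▸ hs) (hsxy ▸ hwx)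
  obtain ⟨c, hcz, hcs, hct, hcsq⟩ :=
    exists_mul_eq_act hc hinv hsq hz hw (hsxz ▸ hs) (hsxz ▸ hwx)
  rw [← hsxy] at hb hbs hbsq
  rw [← hsxz] at hcz hcs hcsq
  have hyfix : X.act (sq x) y = y := hs.act_eq_of_square hinv (by rw [hsq y, hsxy])
  have hzfix : X.act (sq x) z = z := hs.act_eq_of_square hinv (by rw [hsq z, hsxz])
  have hxfix : X.act (sq x) x = x := hs.act_eq_of_square hinv (hsq x)
  have hza : X.mul z a = {b, X.act (sq x) b} := mul_eq_of_special_triple hc hs hzfix hzx ha hb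
  have hya : X.mul y a = {c, X.act (sq x) c} :=
    mul_eq_of_special_triple hc hs hyfix (by rw [hc, hxy]) ha hcz
  have hxb : X.mul x b = {c, X.act (sq x) c} := mul_eq_of_special_triple hc hs hxfix hxy hb hcz
  have hne {p : T} (hp : sq p = sq w ∨ sq p = X.act (sq x) (sq w)) : sq p ≠ sq x := by
    rcases hp with hp | hp
    · rwa [hp]
    · intro h
      apply hw
      rw [isTwoTorsion_iff (hsq w), ← hs.act_act (sq w), ← hp, h]
      exact act_eq_of_mul hs
  have hfix_of {p : T} (hp : sq p = sq w ∨ sq p = X.act (sq x) (sq w))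
      (h : X.act (sq x) (sq p) = sq p) : X.act (sq x) (sq w) = sq w := by
    rcases hp with hp | hp
    · rwa [hp] at h
    · rw [hp, hs.act_act] at h
      exact h.symm
  have hfix : X.act (sq x) (sq w) = sq w := by
    by_cases hab : sq a = sq b
    · exact hfix_of hbsq (act_square_eq hc hinv hs (by rw [hsq a, hab]) (hsq b) hbs (hne hbsq) hza)
    by_cases hac : sq a = sq c
    · exact hfix_of hcsq (act_square_eq hc hinv hs (by rw [hsq a, hac]) (hsq c) hcs (hne hcsq) hya)
    have hbc : sq b = sq c := by
      rcases hasq with h₁ | h₁ <;> rcases hbsq with h₂ | h₂ <;> rcases hcsq with h₃ | h₃ <;>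
        simp_all
    exact hfix_of hcsq (act_square_eq hc hinv hs (by rw [hsq b, hbc]) (hsq c) hcs (hne hcsq) hxb)
  rw [hfix, or_self] at hasq hbsq hcsq
  have hafix : X.act (sq x) (sq a) = sq a := by rw [hasq, hfix]
  obtain ⟨q, hq, hqz⟩ := exists_isTwoTorsion_act_eq hc hinv hsq hs hat (hasq.trans hbsq.symm) hbs
    hafix hza
  obtain ⟨r, hr, hry⟩ := exists_isTwoTorsion_act_eq hc hinv hsq hs hat (hasq.trans hcsq.symm) hcs
    hafix hya
  have hmem : X.act r q ∈ X.mul y z := by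
    rw [← hry, ← hqz, hr.act_mul, hq.mul_act hc, hsq (sq a)]
    simp [Multiset.insert_eq_cons, X.act_e]
  rw [hyz, mem_pair, or_self] at hmem
  exact hx (hmem ▸ hr.act hc hq)

end Involutive

section Orders

variable {T : Type u} {X : TwoValuedGroup T} {P : T → ℤ → T} {x : T}

theorem IsPowFamily.mul_self (hP : X.IsPowFamily P) (x : T) : X.mul x x = {X.e, P x 2} := by
  obtain ⟨h0, h1, -, h⟩ := hP x
  simpa [h0, h1] using h 1 le_rfl

theorem ordOf_eq {n : ℕ} (hn : 0 < n) (h : P x n = X.e)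
    (hlt : ∀ m : ℕ, 0 < m → m < n → P x m ≠ X.e) : X.ordOf P x = n := by
  refine IsLeast.csInf_eq ⟨⟨hn, h⟩, fun m hm => ?_⟩
  by_contra hmn
  exact hlt m hm.1 (not_le.1 hmn) hm.2

theorem ordOf_of_isTwoTorsion (hP : X.IsPowFamily P) (hx : X.IsTwoTorsion x) :
    X.ordOf P x = 1 ∨ X.ordOf P x = 2 := by
  by_cases he : x = X.e
  · left
    refine ordOf_eq one_pos ?_ fun m hm hm' => by omega
    rw [Nat.cast_one, (hP x).2.1, he]
  · right
    refine ordOf_eq two_pos ?_ fun m hm hm' => ?_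
    · exact (isTwoTorsion_iff (hP.mul_self x)).1 hx
    · obtain rfl : m = 1 := by omega
      rwa [Nat.cast_one, (hP x).2.1]

theorem OrdGT2.not_isTwoTorsion (hP : X.IsPowFamily P) (h : X.OrdGT2 P x) :
    ¬ X.IsTwoTorsion x := by
  intro hx
  rcases h with h | h <;> rcases ordOf_of_isTwoTorsion hP hx with h' | h' <;> omega

theorem ordOf_eq_four (hinv : X.Involutive) (hc : X.Commutative) (hP : X.IsPowFamily P)
    (hx : ¬ X.IsTwoTorsion x) (hs : X.IsTwoTorsion (P x 2)) : X.ordOf P x = 4 := by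
  have h2 : P x 2 ≠ X.e := fun h => hx ((isTwoTorsion_iff (hP.mul_self x)).2 h)
  have hxe : x ≠ X.e := by
    rintro rfl
    exact hx isTwoTorsion_e
  obtain ⟨-, h1, -, h⟩ := hP x
  have h3 : P x 3 = x := by
    have h₁ := h 2 (by norm_num)
    norm_num at h₁
    rw [h1, hc, hs.mul_eq, hs.act_eq_of_square hinv (hP.mul_self x)] at h₁
    exact (pair_right_injective h₁).symm
  have h4 : P x 4 = X.e := by
    have h₁ := h 3 (by norm_num)
    norm_num at h₁
    rw [h3, hP.mul_self, Multiset.pair_comm] at h₁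
    exact (pair_right_injective h₁).symm
  refine ordOf_eq (by norm_num) (by exact_mod_cast h4) fun m hm hm' => ?_
  interval_cases m
  · rwa [Nat.cast_one, h1]
  · exact_mod_cast h2
  · have : P x ((3 : ℕ) : ℤ) = x := by exact_mod_cast h3
    rwa [this]

end Orders

/-- **Proposition 11.3 (propos_orders124).** In a special involutive commutative
two-valued group: (a) every element has order `1`, `2` or `4`; (b) all elements of order
`4` have the same square: there is `s` with `x² = s` for every `x` of order `4`.
Here `P` is the (unique) family of integer power sequences. -/
theorem special_orders {T : Type u} (X : TwoValuedGroup T)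
    (hc : X.Commutative) (hinv : X.Involutive)
    (P : T → ℤ → T) (hP : X.IsPowFamily P)
    (hs : X.IsSpecial P) :
    (∀ x : T, X.ordOf P x = 1 ∨ X.ordOf P x = 2 ∨ X.ordOf P x = 4) ∧
    (∃ s : T, ∀ x : T, X.ordOf P x = 4 → P x 2 = s) := by
  obtain ⟨x, y, z, hx, hy, hxy⟩ := hs
  have hx' := hx.not_isTwoTorsion hP
  have hy' := hy.not_isTwoTorsion hP
  have hsq : ∀ w, ¬ X.IsTwoTorsion w → P w 2 = P x 2 := fun w hw =>
    square_eq_of_special (sq := fun w => P w 2) hc hinv hP.mul_self hx' hy' hxy hw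
  have hs := (square_eq_of_mul_eq_pair_self hc hinv (hP.mul_self x) (hP.mul_self y) hx' hy' hxy).2
  refine ⟨fun w => ?_, P x 2, fun w hw => hsq w fun h => ?_⟩
  · by_cases hw : X.IsTwoTorsion w
    · exact (ordOf_of_isTwoTorsion hP hw).imp_right Or.inl
    · exact Or.inr (Or.inr (ordOf_eq_four hinv hc hP hw (by rwa [hsq w hw])))
  · rcases ordOf_of_isTwoTorsion hP h with h' | h' <;> omega

end TwoValuedGroup
end

section
/- Let X be an involutive two-valued group and x an arbitrary element of X. Then the subset K ⊆ ℤ consisting of all integers k such that x^k = e is a subgroup of ℤ. If k ∈ K, then x^{l+k} = x^l and x^{−l+k} = x^l for all l ∈ ℤ. Conversely, if x^l = x^m, then either l − m ∈ K or l + m ∈ K. -/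
/-!
Two-valued groups after V.M. Buchstaber, A.P. Veselov and A.A. Gaifullin.

`X.mul x y` is the two-element multiset `x * y`.
-/

universe u v w u' v' w'

namespace TwoValuedGroup

/-- Multiplication of any integer power `x^k` by `x`. -/
theorem IsPowFamily.mul_self_pow {T : Type u} {X : TwoValuedGroup T} {P : T → ℤ → T}
    (hP : X.IsPowFamily P) (x : T) (k : ℤ) :
    X.mul x (P x k) = {P x (k - 1), P x (k + 1)} := by
  obtain ⟨h0, h1, hneg, hmul⟩ := hP x
  rcases lt_trichotomy k 0 with hk | rfl | hk
  · have h := hmul (-k) (by lia)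
    rw [hneg, ← hneg (-k - 1), ← hneg (-k + 1), Multiset.pair_comm] at h
    convert h using 4 <;> ring_nf
  · have h := hneg 1
    rw [h0, X.mul_e]
    simp [h, h1]
  · exact hmul k hk

/-- The multiplication rule for powers with a natural left exponent. -/
theorem IsPowFamily.natCast_pow_mul_pow {T : Type u} {X : TwoValuedGroup T} {P : T → ℤ → T}
    (hP : X.IsPowFamily P) (x : T) (n : ℕ) (l : ℤ) :
    X.mul (P x n) (P x l) = {P x (n + l), P x (n - l)} := by
  obtain ⟨h0, h1, hneg, -⟩ := hP x
  induction n using Nat.twoStepInduction with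
  | zero => simp [h0, X.e_mul, hneg]
  | one =>
    rw [Nat.cast_one, h1, hP.mul_self_pow, Multiset.pair_comm, ← hneg (l - 1), neg_sub, add_comm]
  | more n ih ih' =>
    have h := X.assoc x (P x ((n + 1 : ℕ) : ℤ)) (P x l)
    rw [hP.mul_self_pow, ih'] at h
    simp only [Multiset.insert_eq_cons, Multiset.cons_bind, Multiset.singleton_bind,
      hP.mul_self_pow] at h
    have e : ((n + 1 : ℕ) : ℤ) - 1 = n := by push_cast; ring
    rw [e, ih] at h
    have e₁ : ((n + 1 : ℕ) : ℤ) + l - 1 = n + l := by push_cast; ring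
    have e₂ : ((n + 1 : ℕ) : ℤ) - l - 1 = n - l := by push_cast; ring
    have e₃ : ((n + 1 : ℕ) : ℤ) + l + 1 = (n + 2 : ℕ) + l := by push_cast; ring
    have e₄ : ((n + 1 : ℕ) : ℤ) - l + 1 = (n + 2 : ℕ) - l := by push_cast; ring
    have e₅ : ((n + 1 : ℕ) : ℤ) + 1 = (n + 2 : ℕ) := by push_cast; ring
    rw [e₁, e₂, e₃, e₄, e₅] at h
    refine add_left_cancel (h.trans ?_)
    simp only [Multiset.insert_eq_cons, ← Multiset.singleton_add]
    abel

/-- The multiplication rule `x^k * x^l = [x^{k+l}, x^{k-l}]`. -/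
theorem IsPowFamily.pow_mul_pow {T : Type u} {X : TwoValuedGroup T} {P : T → ℤ → T}
    (hP : X.IsPowFamily P) (x : T) (k l : ℤ) :
    X.mul (P x k) (P x l) = {P x (k + l), P x (k - l)} := by
  have hneg := (hP x).2.2.1
  obtain ⟨n, rfl | rfl⟩ := k.eq_nat_or_neg
  · exact hP.natCast_pow_mul_pow x n l
  · rw [hneg, hP.natCast_pow_mul_pow, Multiset.pair_comm, ← hneg (n - l), ← hneg (n + l)]
    congr 3 <;> ring_nf

/-- In an involutive two-valued group every square contains the identity. -/
theorem Involutive.e_mem_mul_self {T : Type u} {X : TwoValuedGroup T} (hinv : X.Involutive)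
    (x : T) : X.e ∈ X.mul x x := by
  simpa [hinv x] using X.e_mem_mul_inv x

/-- If `x^k = e`, the power sequence of `x` is invariant under `l ↦ l + k` and `l ↦ -l + k`. -/
theorem IsPowFamily.pow_add_of_pow_eq_e {T : Type u} {X : TwoValuedGroup T} {P : T → ℤ → T}
    (hP : X.IsPowFamily P) {x : T} {k : ℤ} (hk : P x k = X.e) (l : ℤ) :
    P x (l + k) = P x l ∧ P x (-l + k) = P x l := by
  have h := hP.pow_mul_pow x k l
  rw [hk, X.e_mul] at h
  have mem : ∀ y ∈ ({P x (k + l), P x (k - l)} : Multiset T), y = P x l := by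
    rw [← h]
    simp
  rw [add_comm l, neg_add_eq_sub]
  exact ⟨mem _ (by simp), mem _ (by simp)⟩

/-- **Lemma 2.5 (lem_sequence_null).** In an involutive two-valued group, the set
`K = {k : ℤ | x^k = e}` is a subgroup of `ℤ`; if `k ∈ K` then `x^{±l+k} = x^l` for all
`l ∈ ℤ`; conversely, if `x^l = x^m` then `l - m ∈ K` or `l + m ∈ K`.
Here `P` is the (unique) family of integer power sequences. -/
theorem pow_eq_e_subgroup {T : Type u} (X : TwoValuedGroup T) (hinv : X.Involutive)
    (P : T → ℤ → T) (hP : X.IsPowFamily P) (x : T) :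
    (∃ K : AddSubgroup ℤ, ∀ k : ℤ, k ∈ K ↔ P x k = X.e) ∧
    (∀ k l : ℤ, P x k = X.e → P x (l + k) = P x l ∧ P x (-l + k) = P x l) ∧
    (∀ l m : ℤ, P x l = P x m → P x (l - m) = X.e ∨ P x (l + m) = X.e) := by
  have hshift := fun k l (hk : P x k = X.e) => hP.pow_add_of_pow_eq_e hk l
  obtain ⟨h0, -, hneg, -⟩ := hP x
  refine ⟨⟨{ carrier := {k | P x k = X.e}
             zero_mem' := h0
             add_mem' := fun {a b} ha hb => (hshift b a hb).1.trans ha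
             neg_mem' := fun {a} ha => (hneg a).trans ha }, fun _ => Iff.rfl⟩, hshift, ?_⟩
  intro l m hlm
  have h := hinv.e_mem_mul_self (P x l)
  nth_rw 2 [hlm] at h
  rw [hP.pow_mul_pow] at h
  simp only [Multiset.insert_eq_cons, Multiset.mem_cons, Multiset.mem_singleton] at h
  exact h.symm.imp Eq.symm Eq.symm

end TwoValuedGroup
end
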